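/- Let D = {(x,y,z) ∈ (2^ω)³ : ∃n (x(n) ≠ y(n) ∧ x(n) ≠ z(n) ∧ y(n+1) ≠ z(n+1))}. Then: (1) D is a dense open subset of (2^ω)³; (2) for every E_0-tree map Φ, the triple (Φ((010)^∞), Φ((110)^∞), Φ(1^∞)) is pairwise E_0-inequivalent and does not belong to D; (3) consequently, for every Borel set B ⊆ 2^ω admitting a Borel reduction of E_0 into E_0 ↾ B, [B]³_{E_0} is not contained in D; that is, E_0 does not have the 3-Mycielski property. -/

import Mathlib

open Set Function

/-- The eventual-agreement equivalence relation `E₀`: `x E₀ y` iff `∃ n ∀ k > n, x k = y k`. -/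
def E0 {α : Type*} (x y : ℕ → α) : Prop := ∃ n, ∀ k > n, x k = y k

/-- The finite initial segment `s ⌢ v 0 (x 0) ⌢ ⋯ ⌢ v (n-1) (x (n-1))`. -/
def blockPrefix (s : List Bool) (v : ℕ → Bool → List Bool) (x : ℕ → Bool) : ℕ → List Bool
  | 0 => s
  | n + 1 => blockPrefix s v x n ++ v n (x n)

/-- The map `x ↦ s ⌢ v 0 (x 0) ⌢ v 1 (x 1) ⌢ ⋯` determined by a stem `s` and blocks `v`. -/
def e0TreeMapOf (s : List Bool) (v : ℕ → Bool → List Bool) (x : ℕ → Bool) : ℕ → Bool :=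
  fun m => (blockPrefix s v x (m + 1)).getD m false

/-- Conditions on the blocks of an `E₀`-tree. -/
def IsE0Blocks (v : ℕ → Bool → List Bool) : Prop :=
  (∀ n i, (v n i).head? = some i) ∧ ∀ n, (v n false).length = (v n true).length

/-- `Φ` is an `E₀`-tree map. -/
def IsE0TreeMap (Φ : (ℕ → Bool) → (ℕ → Bool)) : Prop :=
  ∃ s v, IsE0Blocks v ∧ Φ = e0TreeMapOf s v

/-- `[B]³_{E₀}`: triples from `B` that are pairwise `E₀`-inequivalent. -/
def triplesE0 (B : Set (ℕ → Bool)) : Set ((ℕ → Bool) × (ℕ → Bool) × (ℕ → Bool)) :=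
  {p | p.1 ∈ B ∧ p.2.1 ∈ B ∧ p.2.2 ∈ B ∧
    ¬E0 p.1 p.2.1 ∧ ¬E0 p.1 p.2.2 ∧ ¬E0 p.2.1 p.2.2}

/-- The dense open set witnessing the failure of the 3-Mycielski property for `E₀`. -/
def D5 : Set ((ℕ → Bool) × (ℕ → Bool) × (ℕ → Bool)) :=
  {p | ∃ n, p.1 n ≠ p.2.1 n ∧ p.1 n ≠ p.2.2 n ∧ p.2.1 (n + 1) ≠ p.2.2 (n + 1)}

/-- The periodic sequence `(010)^∞`. -/
def x010 : ℕ → Bool := fun n => decide (n % 3 = 1)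

/-- The periodic sequence `(110)^∞`. -/
def x110 : ℕ → Bool := fun n => decide (n % 3 ≠ 2)

/-- The constant sequence `1^∞`. -/
def x1 : ℕ → Bool := fun _ => true

theorem isOpen_D5 : IsOpen D5 := by
  have : D5 = ⋃ n, {p : (ℕ → Bool) × (ℕ → Bool) × (ℕ → Bool) |
      p.1 n ≠ p.2.1 n ∧ p.1 n ≠ p.2.2 n ∧ p.2.1 (n + 1) ≠ p.2.2 (n + 1)} := by
    ext p; simp [D5]
  rw [this]
  refine isOpen_iUnion fun n => ?_
  have h1 : Continuous fun p : (ℕ → Bool) × (ℕ → Bool) × (ℕ → Bool) =>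
      (p.1 n, p.2.1 n, p.2.2 n, p.2.1 (n + 1), p.2.2 (n + 1)) := by fun_prop
  exact (isOpen_discrete {q : Bool × Bool × Bool × Bool × Bool |
    q.1 ≠ q.2.1 ∧ q.1 ≠ q.2.2.1 ∧ q.2.2.2.1 ≠ q.2.2.2.2}).preimage h1

theorem tendsto_of_eventually_agree {u : ℕ → ℕ → Bool} {x : ℕ → Bool}
    (h : ∀ n, ∀ m < n, u n m = x m) : Filter.Tendsto u Filter.atTop (nhds x) := by
  refine tendsto_pi_nhds.2 fun m => tendsto_const_nhds.congr' ?_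
  filter_upwards [Filter.eventually_gt_atTop m] with n hn using (h n m hn).symm

theorem dense_D5 : Dense D5 := by
  rintro ⟨x, y, z⟩
  refine mem_closure_of_tendsto (f := fun n : ℕ =>
    ((fun m => if m < n then x m else true : ℕ → Bool),
      (fun m => if m < n then y m else decide (m = n + 1) : ℕ → Bool),
      (fun m => if m < n then z m else false : ℕ → Bool)))
    (b := Filter.atTop) ?_ (Filter.Eventually.of_forall fun n => ⟨n, by simp⟩)
  refine Filter.Tendsto.prodMk_nhds ?_ (Filter.Tendsto.prodMk_nhds ?_ ?_) <;>
    exact tendsto_of_eventually_agree fun n m hm => by simp [hm]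

/-- A map `Ψ` whose values are built from consecutive blocks `[d n, d (n + 1))`, the `n`-th block
depending only on the `n`-th coordinate of the argument and starting with it. -/
structure IsBlockMap (d : ℕ → ℕ) (Ψ : (ℕ → Bool) → ℕ → Bool) : Prop where
  strictMono : StrictMono d
  stem : ∀ x y m, m < d 0 → Ψ x m = Ψ y m
  block : ∀ x y n m, d n ≤ m → m < d (n + 1) → x n = y n → Ψ x m = Ψ y m
  apply_start : ∀ x n, Ψ x (d n) = x n

theorem StrictMono.exists_block {d : ℕ → ℕ} (hd : StrictMono d) {m : ℕ} (hm : d 0 ≤ m) :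
    ∃ n, d n ≤ m ∧ m < d (n + 1) := by
  have hex : ∃ n, m < d n := ⟨m + 1, (Nat.lt_succ_self m).trans_le (hd.id_le (m + 1))⟩
  classical
  obtain ⟨n, hn⟩ : ∃ n, Nat.find hex = n + 1 := by
    refine Nat.exists_eq_succ_of_ne_zero fun h0 => ?_
    have := Nat.find_spec hex
    rw [h0] at this
    omega
  refine ⟨n, not_lt.1 (Nat.find_min hex (by omega)), ?_⟩
  rw [← hn]
  exact Nat.find_spec hex

namespace IsBlockMap

variable {d : ℕ → ℕ} {Ψ : (ℕ → Bool) → ℕ → Bool}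

theorem not_E0 (h : IsBlockMap d Ψ) {x y : ℕ → Bool} (hxy : ¬E0 x y) : ¬E0 (Ψ x) (Ψ y) := by
  rintro ⟨n, hn⟩
  refine hxy ⟨n, fun k hk => ?_⟩
  have := hn (d k) (hk.trans_le (h.strictMono.id_le k))
  rwa [h.apply_start, h.apply_start] at this

theorem mem_triplesE0 (h : IsBlockMap d Ψ) :
    (Ψ x010, Ψ x110, Ψ x1) ∈ triplesE0 (range Ψ) := by
  refine ⟨mem_range_self _, mem_range_self _, mem_range_self _,
    h.not_E0 ?_, h.not_E0 ?_, h.not_E0 ?_⟩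
  · rintro ⟨n, hn⟩
    have := hn (3 * (n + 1)) (by omega)
    simp [x010, x110] at this
  · rintro ⟨n, hn⟩
    have := hn (3 * (n + 1)) (by omega)
    simp [x010, x1] at this
  · rintro ⟨n, hn⟩
    have := hn (3 * (n + 1) + 2) (by omega)
    simp [x110, x1] at this

theorem notMem_D5 (h : IsBlockMap d Ψ) : (Ψ x010, Ψ x110, Ψ x1) ∉ D5 := by
  rintro ⟨m, h1, h2, h3⟩
  simp only at h1 h2 h3
  by_cases hm : m < d 0
  · exact h1 (h.stem _ _ _ hm)
  obtain ⟨n, hn, hn'⟩ := h.strictMono.exists_block (not_lt.1 hm)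
  have e1 : x010 n ≠ x110 n := fun e => h1 (h.block _ _ n m hn hn' e)
  have hmod : n % 3 = 0 := by
    simp only [x010, x110, ne_eq, decide_eq_decide] at e1
    omega
  have hlt := h.strictMono (Nat.lt_succ_self (n + 1))
  rcases (Nat.succ_le_of_lt hn').lt_or_eq with hlt' | heq
  · refine h3 (h.block _ _ n (m + 1) (by omega) hlt' ?_)
    simp [x110, x1, hmod]
  · refine h3 (h.block _ _ (n + 1) (m + 1) heq.ge (heq.trans_lt hlt) ?_)
    simp only [x110, x1, decide_eq_true_eq]
    omega

end IsBlockMap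

theorem IsE0Blocks.length_eq {v : ℕ → Bool → List Bool} (hv : IsE0Blocks v) (n : ℕ) (i : Bool) :
    (v n i).length = (v n false).length := by
  cases i
  · rfl
  · exact (hv.2 n).symm

theorem IsE0Blocks.length_blockPrefix {v : ℕ → Bool → List Bool} (hv : IsE0Blocks v)
    (s : List Bool) (x y : ℕ → Bool) (n : ℕ) :
    (blockPrefix s v x n).length = (blockPrefix s v y n).length := by
  induction n with
  | zero => rfl
  | succ n ih => simp [blockPrefix, ih, hv.length_eq n (x n), hv.length_eq n (y n)]

theorem IsE0Blocks.length_pos {v : ℕ → Bool → List Bool} (hv : IsE0Blocks v) (n : ℕ) (i : Bool) :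
    0 < (v n i).length := by
  have := hv.1 n i
  cases h : v n i with
  | nil => simp [h] at this
  | cons => simp

theorem IsE0Blocks.lt_length_blockPrefix {v : ℕ → Bool → List Bool} (hv : IsE0Blocks v)
    (s : List Bool) (x : ℕ → Bool) (n : ℕ) : n < (blockPrefix s v x (n + 1)).length := by
  induction n with
  | zero => simpa [blockPrefix] using Or.inr (hv.length_pos 0 (x 0))
  | succ n ih =>
    rw [blockPrefix, List.length_append]
    have := hv.length_pos (n + 1) (x (n + 1))
    omega

theorem blockPrefix_prefix (s : List Bool) (v : ℕ → Bool → List Bool) (x : ℕ → Bool) {m n : ℕ}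
    (h : m ≤ n) : blockPrefix s v x m <+: blockPrefix s v x n := by
  induction n, h using Nat.le_induction with
  | base => exact List.prefix_rfl
  | succ n _ ih => exact ih.trans (List.prefix_append _ _)

theorem IsE0Blocks.e0TreeMapOf_apply {v : ℕ → Bool → List Bool} (hv : IsE0Blocks v)
    (s : List Bool) (x : ℕ → Bool) {m n : ℕ} (h : m < (blockPrefix s v x n).length) :
    e0TreeMapOf s v x m = (blockPrefix s v x n).getD m false := by
  have key : ∀ {a b : List Bool}, a <+: b → m < a.length → a.getD m false = b.getD m false := by
    rintro a _ ⟨t, rfl⟩ hm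
    rw [List.getD_append _ _ _ _ hm]
  rw [e0TreeMapOf]
  rcases le_total n (m + 1) with hle | hle
  · exact (key (blockPrefix_prefix s v x hle) h).symm
  · exact key (blockPrefix_prefix s v x hle) (hv.lt_length_blockPrefix s x m)

theorem IsE0Blocks.isBlockMap {v : ℕ → Bool → List Bool} (hv : IsE0Blocks v) (s : List Bool) :
    IsBlockMap (fun n => (blockPrefix s v x1 n).length) (e0TreeMapOf s v) where
  strictMono := strictMono_nat_of_lt_succ fun n => by
    have := hv.length_pos n (x1 n)
    simp only [blockPrefix, List.length_append]
    omega
  stem x y m hm := by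
    rw [hv.e0TreeMapOf_apply s x (n := 0) hm, hv.e0TreeMapOf_apply s y (n := 0) hm]
    rfl
  block x y n m h1 h2 hxy := by
    have hx := hv.length_blockPrefix s x x1 n
    have hy := hv.length_blockPrefix s y x1 n
    rw [hv.e0TreeMapOf_apply s x (n := n + 1) (by rwa [hv.length_blockPrefix s x x1]),
      hv.e0TreeMapOf_apply s y (n := n + 1) (by rwa [hv.length_blockPrefix s y x1]),
      blockPrefix, blockPrefix, List.getD_append_right _ _ _ _ (by omega),
      List.getD_append_right _ _ _ _ (by omega), hx, hy, hxy]
  apply_start x n := by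
    have hx := hv.length_blockPrefix s x x1 n
    have hp := hv.length_pos n (x n)
    have hh := hv.1 n (x n)
    rw [hv.e0TreeMapOf_apply s x (n := n + 1)
        (by simp only [blockPrefix, List.length_append]; omega),
      blockPrefix, List.getD_append_right _ _ _ _ (by omega), hx, Nat.sub_self]
    cases h : v n (x n) with
    | nil => simp [h] at hp
    | cons a l => simpa [h] using hh

/-- Flip the bits of `y` at the positions in `F`. -/
def flipBits (F : Finset ℕ) (y : ℕ → Bool) : ℕ → Bool := fun m => xor (y m) (decide (m ∈ F))

theorem flipBits_flipBits (F : Finset ℕ) (y : ℕ → Bool) : flipBits F (flipBits F y) = y := by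
  funext m; simp [flipBits]

theorem measurable_flipBits (F : Finset ℕ) : Measurable (flipBits F) :=
  measurable_pi_lambda _ fun m =>
    (measurable_of_finite fun b : Bool => xor b (decide (m ∈ F))).comp (measurable_pi_apply m)

theorem E0_flipBits (F : Finset ℕ) (y : ℕ → Bool) : E0 y (flipBits F y) := by
  refine ⟨F.sup id, fun k hk => ?_⟩
  have : k ∉ F := fun h => absurd (Finset.le_sup (f := id) h) (not_le.2 hk)
  simp [flipBits, this]

theorem E0.exists_flipBits {x y : ℕ → Bool} (h : E0 x y) : ∃ F : Finset ℕ, flipBits F x = y := by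
  obtain ⟨n, hn⟩ := h
  refine ⟨(Finset.range (n + 1)).filter fun k => x k ≠ y k, ?_⟩
  funext m
  by_cases hm : m < n + 1
  · cases hx : x m <;> cases hy : y m <;> simp [flipBits, hm, hx, hy]
  · simpa [flipBits, hm] using hn m (by omega)

theorem E0.symm {x y : ℕ → Bool} : E0 x y → E0 y x :=
  fun ⟨n, hn⟩ => ⟨n, fun k hk => (hn k hk).symm⟩

theorem E0.trans {x y z : ℕ → Bool} : E0 x y → E0 y z → E0 x z :=
  fun ⟨n, hn⟩ ⟨m, hm⟩ =>
    ⟨max n m, fun k hk => (hn k (by omega)).trans (hm k (by omega))⟩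

theorem countable_setOf_E0 (x : ℕ → Bool) : {y | E0 x y}.Countable :=
  (countable_range fun F : Finset ℕ => flipBits F x).mono fun _ h => h.exists_flipBits

/-- The `E₀`-saturation of a set. -/
def saturation (T : Set (ℕ → Bool)) : Set (ℕ → Bool) := {x | ∃ t ∈ T, E0 t x}

theorem measurableSet_saturation {T : Set (ℕ → Bool)} (hT : MeasurableSet T) :
    MeasurableSet (saturation T) := by
  have : saturation T = ⋃ F : Finset ℕ, flipBits F ⁻¹' T := by
    ext x
    simp only [saturation, mem_ofPred_eq, mem_iUnion, mem_preimage]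
    constructor
    · rintro ⟨t, ht, htx⟩
      obtain ⟨F, hF⟩ := htx.symm.exists_flipBits
      exact ⟨F, hF ▸ ht⟩
    · rintro ⟨F, hF⟩
      exact ⟨_, hF, (E0_flipBits F x).symm⟩
  rw [this]
  exact MeasurableSet.iUnion fun F => measurable_flipBits F hT

open MeasureTheory ProbabilityTheory

/-- The fair coin-flipping measure on Cantor space. -/
noncomputable def coinMeasure : Measure (ℕ → Bool) :=
  Measure.infinitePi fun _ => (PMF.uniformOfFintype Bool).toMeasure

instance : IsProbabilityMeasure coinMeasure := by
  unfold coinMeasure; infer_instance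

instance : NullSingletonClass coinMeasure := by
  refine ⟨fun x => ?_⟩
  have hle : ∀ n : ℕ, coinMeasure {x} ≤ (2⁻¹ : ENNReal) ^ n := fun n => by
    refine (measure_mono (t := (Finset.range n : Set ℕ).pi fun i => {x i}) ?_).trans ?_
    · rintro _ rfl i _
      rfl
    · rw [coinMeasure, Measure.infinitePi_pi _ (fun _ _ => measurableSet_singleton _)]
      simp
  exact le_antisymm (ge_of_tendsto'
    (ENNReal.tendsto_pow_atTop_nhds_zero_of_lt_one (by simp)) hle) zero_le

/-- Ergodicity of `E₀` with respect to the coin-flipping measure. -/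
theorem coinMeasure_zero_or_one {A : Set (ℕ → Bool)} (hA : MeasurableSet A)
    (hinv : ∀ x y, E0 x y → x ∈ A → y ∈ A) : coinMeasure A = 0 ∨ coinMeasure A = 1 := by
  have hind : iIndep (fun n : ℕ => MeasurableSpace.comap (fun x : ℕ → Bool => x n) ⊤)
      coinMeasure :=
    iIndepFun_infinitePi (X := fun _ b => b) (fun _ => measurable_id)
  refine measure_zero_or_one_of_measurableSet_limsup_atTop
    (fun n => (measurable_pi_apply n).comap_le) hind ?_
  rw [Filter.limsup_eq_iInf_iSup_of_nat, MeasurableSpace.measurableSet_iInf]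
  intro n
  have hm : Measurable[⨆ i, ⨆ (_ : i ≥ n),
      MeasurableSpace.comap (fun x : ℕ → Bool => x i) ⊤, MeasurableSpace.pi]
      fun (x : ℕ → Bool) k => if k < n then false else x k := by
    refine @measurable_pi_lambda _ _ _ (_) _ _ fun k => ?_
    by_cases hk : k < n
    · simp only [hk, if_true]
      exact @measurable_const _ _ _ (_) _
    · simp only [hk, if_false]
      refine Measurable.mono (comap_measurable _) ?_ le_rfl
      exact le_iSup₂_of_le k (not_lt.1 hk) le_rfl
  have hE : ∀ x : ℕ → Bool, E0 x fun k => if k < n then false else x k := fun x =>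
    ⟨n, fun k hk => by simp [not_lt.2 hk.le]⟩
  have : A = (fun (x : ℕ → Bool) k => if k < n then false else x k) ⁻¹' A := by
    ext x
    exact ⟨hinv _ _ (hE x), hinv _ _ (hE x).symm⟩
  rw [this]
  exact hm hA

/-- If `f` is a measurable reduction of `E₀` to itself, then partial transversals are null for
the push-forward of the coin-flipping measure. -/
theorem map_coinMeasure_transversal {f : (ℕ → Bool) → ℕ → Bool} (hf : Measurable f)
    (hred : ∀ x y, E0 x y ↔ E0 (f x) (f y)) {T : Set (ℕ → Bool)} (hT : MeasurableSet T)
    (htr : ∀ x ∈ T, ∀ y ∈ T, E0 x y → x = y) : coinMeasure.map f T = 0 := by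
  have h01 : ∀ S, MeasurableSet S →
      coinMeasure (f ⁻¹' saturation S) = 0 ∨ coinMeasure (f ⁻¹' saturation S) = 1 := fun S hS =>
    coinMeasure_zero_or_one (hf (measurableSet_saturation hS)) fun x y hxy ⟨t, ht, htx⟩ =>
      ⟨t, ht, htx.trans ((hred x y).1 hxy)⟩
  have hsub : f ⁻¹' T ⊆ f ⁻¹' saturation T := fun x hx => ⟨f x, hx, 0, fun _ _ => rfl⟩
  rw [Measure.map_apply hf hT]
  rcases h01 T hT with h0 | h1
  · exact measure_mono_null hsub h0
  exfalso
  have hTn : ∀ n b, MeasurableSet (T ∩ {t | t n = b}) := fun n b =>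
    hT.inter (measurableSet_eq_fun (measurable_pi_apply n) measurable_const)
  have hbit : ∀ n, ∃ b, coinMeasure (f ⁻¹' saturation (T ∩ {t | t n = b})) = 1 := fun n => by
    by_contra! hne
    have hz : ∀ b, coinMeasure (f ⁻¹' saturation (T ∩ {t | t n = b})) = 0 := fun b =>
      (h01 _ (hTn n b)).resolve_right (hne b)
    have : coinMeasure (f ⁻¹' saturation T) = 0 :=
      measure_mono_null (t := ⋃ b, f ⁻¹' saturation (T ∩ {t | t n = b}))
        (fun x ⟨t, ht, htx⟩ => mem_iUnion.2 ⟨t n, t, ⟨ht, rfl⟩, htx⟩) (measure_iUnion_null hz)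
    simp [this] at h1
  choose b hb using hbit
  have hae : ∀ᵐ x ∂coinMeasure, ∀ n, x ∈ f ⁻¹' saturation (T ∩ {t | t n = b n}) :=
    ae_all_iff.2 fun n =>
      (prob_compl_eq_zero_iff (hf (measurableSet_saturation (hTn n (b n))))).2 (hb n)
  have hclass : ∀ x, (∀ n, x ∈ f ⁻¹' saturation (T ∩ {t | t n = b n})) → E0 b (f x) := by
    intro x hx
    obtain ⟨t, ⟨ht, -⟩, htx⟩ := hx 0
    have : t = b := funext fun n => by
      obtain ⟨t', ⟨ht', hn⟩, htx'⟩ := hx n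
      rw [htr t ht t' ht' (htx.trans htx'.symm)]
      exact hn
    exact this ▸ htx
  obtain ⟨x₀, hx₀⟩ := hae.exists
  have hcls : ∀ᵐ x ∂coinMeasure, x ∈ {y | E0 x₀ y} := by
    filter_upwards [hae] with x hx
    exact (hred x₀ x).2 ((hclass x₀ hx₀).symm.trans (hclass x hx))
  have hnull := (countable_setOf_E0 x₀).measure_zero coinMeasure
  have hno : ∀ᵐ x ∂coinMeasure, x ∉ {y | E0 x₀ y} := measure_eq_zero_iff_ae_notMem.1 hnull
  obtain ⟨x, h, h'⟩ := (hcls.and hno).exists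
  exact h' h

section Fusion

variable {μ : Measure (ℕ → Bool)}

theorem exists_flipBits_inter_ne_zero
    (hμ : ∀ T, MeasurableSet T → (∀ x ∈ T, ∀ y ∈ T, E0 x y → x = y) → μ T = 0)
    {A : Set (ℕ → Bool)} (hA : MeasurableSet A) (h0 : μ A ≠ 0) :
    ∃ F : Finset ℕ, F.Nonempty ∧ μ (A ∩ flipBits F ⁻¹' A) ≠ 0 := by
  by_contra! hne
  set N : Set (ℕ → Bool) := ⋃ F : {F : Finset ℕ // F.Nonempty}, A ∩ flipBits F.1 ⁻¹' A with hN
  have hNm : MeasurableSet N :=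
    MeasurableSet.iUnion fun F => hA.inter (measurable_flipBits F.1 hA)
  have hN0 : μ N = 0 := measure_iUnion_null fun F => hne F.1 F.2
  have hT := hμ (A \ N) (hA.diff hNm) fun x hx y hy hxy => by
    obtain ⟨F, rfl⟩ := hxy.exists_flipBits
    rcases F.eq_empty_or_nonempty with rfl | hF
    · funext m; simp [flipBits]
    · exact (hx.2 (mem_iUnion.2 ⟨⟨F, hF⟩, hx.1, hy.1⟩)).elim
  rw [measure_sdiff_null hN0] at hT
  exact h0 hT

theorem exists_fusion_step
    (hμ : ∀ T, MeasurableSet T → (∀ x ∈ T, ∀ y ∈ T, E0 x y → x = y) → μ T = 0)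
    {A : Set (ℕ → Bool)} {e : ℕ} (hA : MeasurableSet A) (h0 : μ A ≠ 0)
    (hag : ∀ x ∈ A, ∀ y ∈ A, ∀ m < e, x m = y m) :
    ∃ (F : Finset ℕ) (A' : Set (ℕ → Bool)) (e' : ℕ), F.Nonempty ∧ (∀ i ∈ F, e ≤ i ∧ i < e') ∧
      A' ⊆ A ∧ (∀ y ∈ A', flipBits F y ∈ A) ∧ MeasurableSet A' ∧ μ A' ≠ 0 ∧
      ∀ x ∈ A', ∀ y ∈ A', ∀ m < e', x m = y m := by
  obtain ⟨F, hF, hF0⟩ := exists_flipBits_inter_ne_zero hμ hA h0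
  obtain ⟨y, hyA, hyF⟩ := nonempty_of_measure_ne_zero hF0
  have hFe : ∀ i ∈ F, e ≤ i := fun i hi => by
    by_contra! hlt
    have := hag y hyA _ hyF i hlt
    simp [flipBits, hi] at this
  set e' := F.sup id + 1
  let r : (ℕ → Bool) → Fin e' → Bool := fun x i => x i
  have hr : Measurable r := by fun_prop
  obtain ⟨u, hu⟩ : ∃ u, μ (A ∩ flipBits F ⁻¹' A ∩ r ⁻¹' {u}) ≠ 0 := by
    by_contra! hz
    exact hF0 (measure_mono_null (t := ⋃ u, A ∩ flipBits F ⁻¹' A ∩ r ⁻¹' {u})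
      (fun x hx => mem_iUnion.2 ⟨r x, hx, rfl⟩)
      (measure_iUnion_null hz))
  refine ⟨F, _, e', hF,
    fun i hi => ⟨hFe i hi, Nat.lt_succ_of_le (Finset.le_sup (f := id) hi)⟩,
    fun x hx => hx.1.1, fun x hx => hx.1.2,
    (hA.inter (measurable_flipBits F hA)).inter (hr (measurableSet_singleton u)), hu, ?_⟩
  rintro x ⟨-, hx⟩ z ⟨-, hz⟩ m hm
  exact congrFun ((show r x = u from hx).trans (show r z = u from hz).symm) ⟨m, hm⟩

/-- A closed set that is not null for a measure vanishing on partial `E₀`-transversals contains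
the range of a block map. -/
theorem exists_isBlockMap_range_subset
    (hμ : ∀ T, MeasurableSet T → (∀ x ∈ T, ∀ y ∈ T, E0 x y → x = y) → μ T = 0)
    {C : Set (ℕ → Bool)} (hC : IsClosed C) (h0 : μ C ≠ 0) :
    ∃ d Ψ, IsBlockMap d Ψ ∧ range Ψ ⊆ C := by
  let S := {p : Set (ℕ → Bool) × ℕ // MeasurableSet p.1 ∧ μ p.1 ≠ 0 ∧
    ∀ x ∈ p.1, ∀ y ∈ p.1, ∀ m < p.2, x m = y m}
  have step : ∀ p : S, ∃ q : S × Finset ℕ, q.2.Nonempty ∧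
      (∀ i ∈ q.2, p.1.2 ≤ i ∧ i < q.1.1.2) ∧ q.1.1.1 ⊆ p.1.1 ∧
      ∀ y ∈ q.1.1.1, flipBits q.2 y ∈ p.1.1 := fun p => by
    obtain ⟨F, A', e', h1, h2, h3, h4, h5⟩ := exists_fusion_step hμ p.2.1 p.2.2.1 p.2.2.2
    exact ⟨(⟨(A', e'), h5⟩, F), h1, h2, h3, h4⟩
  choose g hgne hgF hgsub hgflip using step
  let s : ℕ → S := fun n => Nat.rec ⟨(C, 0), hC.measurableSet, h0, by simp⟩ (fun _ p => (g p).1) n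
  let A : ℕ → Set (ℕ → Bool) := fun n => (s n).1.1
  let e : ℕ → ℕ := fun n => (s n).1.2
  let F : ℕ → Finset ℕ := fun n => (g (s n)).2
  have hF : ∀ n, (F n).Nonempty := fun n => hgne (s n)
  have hFe : ∀ n, ∀ i ∈ F n, e n ≤ i ∧ i < e (n + 1) := fun n => hgF (s n)
  have hAsub : ∀ n, A (n + 1) ⊆ A n := fun n => hgsub (s n)
  have hAflip : ∀ n, ∀ y ∈ A (n + 1), flipBits (F n) y ∈ A n := fun n => hgflip (s n)
  have hag : ∀ n, ∀ x ∈ A n, ∀ y ∈ A n, ∀ m < e n, x m = y m := fun n => (s n).2.2.2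
  have hAne : ∀ n, (A n).Nonempty := fun n => nonempty_of_measure_ne_zero (s n).2.2.1
  have hAanti : Antitone A := antitone_nat_of_succ_le hAsub
  let d : ℕ → ℕ := fun n => (F n).min' (hF n)
  have hdF : ∀ n, d n ∈ F n := fun n => (F n).min'_mem _
  have hdle : ∀ n, ∀ i ∈ F n, d n ≤ i := fun n i hi => (F n).min'_le i hi
  have hemono : StrictMono e := strictMono_nat_of_lt_succ fun n =>
    (hFe n _ (hdF n)).1.trans_lt (hFe n _ (hdF n)).2
  have hdmono : StrictMono d := strictMono_nat_of_lt_succ fun n =>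
    (hFe n _ (hdF n)).2.trans_le (hFe (n + 1) _ (hdF (n + 1))).1
  have hFlt : ∀ n, ∀ i ∈ F n, i < d (n + 1) := fun n i hi =>
    (hFe n i hi).2.trans_le (hFe (n + 1) _ (hdF (n + 1))).1
  have hFuniq : ∀ n k m, d n ≤ m → m < d (n + 1) → m ∈ F k → k = n := by
    intro n k m h1 h2 hk
    rcases lt_trichotomy k n with h | h | h
    · have := hFlt k m hk
      have := hdmono.monotone (show k + 1 ≤ n from h)
      omega
    · exact h
    · have := hdle k m hk
      have := hdmono.monotone (show n + 1 ≤ k from h)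
      omega
  choose a ha using hAne
  let z : ℕ → Bool := fun m => a (m + 1) m
  have hz : ∀ n, ∀ y ∈ A n, ∀ m < e n, y m = z m := by
    intro n y hy m hm
    rcases le_total n (m + 1) with h | h
    · exact hag n y hy _ (hAanti h (ha (m + 1))) m hm
    · exact hag (m + 1) y (hAanti h hy) _ (ha (m + 1)) m
        ((Nat.lt_succ_self m).trans_le (hemono.id_le (m + 1)))
  classical
  let Ψ : (ℕ → Bool) → ℕ → Bool := fun x m =>
    xor (z m) (decide (∃ n, x n ≠ z (d n) ∧ m ∈ F n))
  refine ⟨d, Ψ, ⟨hdmono, ?_, ?_, ?_⟩, ?_⟩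
  · intro x y m hm
    have : ∀ n, m ∉ F n := fun n hn => by
      have := hdle n m hn
      have := hdmono.monotone (Nat.zero_le n)
      omega
    simp [Ψ, this]
  · intro x y n m h1 h2 hxy
    have : ∀ w : ℕ → Bool, (∃ k, w k ≠ z (d k) ∧ m ∈ F k) ↔ w n ≠ z (d n) ∧ m ∈ F n := fun w =>
      ⟨fun ⟨k, hk, hm⟩ => by obtain rfl := hFuniq n k m h1 h2 hm; exact ⟨hk, hm⟩,
        fun h => ⟨n, h⟩⟩
    simp only [Ψ, this, hxy]
  · intro x n
    have : (∃ k, x k ≠ z (d k) ∧ d n ∈ F k) ↔ x n ≠ z (d n) :=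
      ⟨fun ⟨k, hk, hm⟩ => by
        obtain rfl := hFuniq n k (d n) le_rfl (hdmono (Nat.lt_succ_self n)) hm
        exact hk, fun h => ⟨n, h, hdF n⟩⟩
    simp only [Ψ, this]
    cases x n <;> cases z (d n) <;> rfl
  · rintro _ ⟨x, rfl⟩
    let w : ℕ → (ℕ → Bool) → ℕ → Bool := fun n y m =>
      xor (y m) (decide (∃ k < n, x k ≠ z (d k) ∧ m ∈ F k))
    have hw : ∀ n, ∀ y ∈ A n, w n y ∈ C := by
      intro n
      induction n with
      | zero =>
        intro y hy
        have : w 0 y = y := by funext m; simp [w]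
        rw [this]
        exact hy
      | succ n ih =>
        intro y hy
        by_cases hx : x n = z (d n)
        · have : w (n + 1) y = w n y := by
            funext m
            simp only [w, Nat.lt_succ_iff_lt_or_eq, or_and_right, exists_or, exists_eq_left, hx,
              ne_eq, not_true_eq_false, false_and, or_false]
          rw [this]
          exact ih y (hAsub n hy)
        · have : w (n + 1) y = w n (flipBits (F n) y) := by
            funext m
            by_cases hm : m ∈ F n
            · have hno : ¬∃ k < n, x k ≠ z (d k) ∧ m ∈ F k := fun ⟨k, hk, _, hmk⟩ =>
                hk.ne (hFuniq n k m (hdle n m hm) (hFlt n m hm) hmk)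
              have hyes : ∃ k < n + 1, x k ≠ z (d k) ∧ m ∈ F k := ⟨n, by omega, hx, hm⟩
              simp only [w, flipBits, hno, hyes, hm]
              simp
            · simp only [w, flipBits, Nat.lt_succ_iff_lt_or_eq, or_and_right, exists_or,
                exists_eq_left, hm, and_false, or_false]
              simp
          rw [this]
          exact ih _ (hAflip n y hy)
    refine hC.mem_of_tendsto (tendsto_of_eventually_agree (u := fun n => w n (a n)) ?_)
      (Filter.Eventually.of_forall fun n => hw n _ (ha n))
    intro n m hm
    have hme : m < e n := hm.trans_le (hemono.id_le n)
    have : (∃ k < n, x k ≠ z (d k) ∧ m ∈ F k) ↔ ∃ k, x k ≠ z (d k) ∧ m ∈ F k := by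
      refine ⟨fun ⟨k, _, h⟩ => ⟨k, h⟩, fun ⟨k, h, hmk⟩ => ⟨k, ?_, h, hmk⟩⟩
      by_contra! hk
      have := (hFe k m hmk).1
      have := hemono.monotone hk
      omega
    simp only [w, Ψ, this, hz n _ (ha n) m hme]

end Fusion

/-- A Borel set into which `E₀` Borel-reduces contains the range of a block map. -/
theorem exists_isBlockMap_of_reduction {B : Set (ℕ → Bool)} (hB : MeasurableSet B)
    {f : (ℕ → Bool) → ℕ → Bool} (hf : Measurable f) (hfB : range f ⊆ B)
    (hred : ∀ x y, E0 x y ↔ E0 (f x) (f y)) :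
    ∃ d Ψ, IsBlockMap d Ψ ∧ range Ψ ⊆ B := by
  have hprob : IsProbabilityMeasure (coinMeasure.map f) :=
    Measure.isProbabilityMeasure_map hf.aemeasurable
  have hpos : 0 < coinMeasure.map f B := by
    rw [Measure.map_apply hf hB, preimage_eq_univ_iff.2 hfB]
    simp
  obtain ⟨C, hCB, hC, hC0⟩ := hB.exists_lt_isClosed_of_ne_top (measure_ne_top _ _) hpos
  obtain ⟨d, Ψ, hΨ, hr⟩ := exists_isBlockMap_range_subset
    (fun T hT htr => map_coinMeasure_transversal hf hred hT htr) hC hC0.ne'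
  exact ⟨d, Ψ, hΨ, hr.trans hCB⟩

/-- `E₀` does not have the 3-Mycielski property: `D5` is dense open, every `E₀`-tree map `Φ`
produces a pairwise `E₀`-inequivalent triple in `(range Φ)³` avoiding `D5`, and hence no Borel
set `B` into which `E₀` Borel-reduces (within `B`) satisfies `[B]³_{E₀} ⊆ D5`. -/
theorem e0_not_three_mycielski :
    (IsOpen D5 ∧ Dense D5) ∧
    (∀ Φ : (ℕ → Bool) → (ℕ → Bool), IsE0TreeMap Φ →
      (Φ x010, Φ x110, Φ x1) ∈ triplesE0 (range Φ) ∧ (Φ x010, Φ x110, Φ x1) ∉ D5) ∧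
    (∀ B : Set (ℕ → Bool), MeasurableSet B →
      (∃ f : (ℕ → Bool) → (ℕ → Bool),
        Measurable f ∧ range f ⊆ B ∧ ∀ x y, E0 x y ↔ E0 (f x) (f y)) →
      ¬triplesE0 B ⊆ D5) := by
  refine ⟨⟨isOpen_D5, dense_D5⟩, ?_, ?_⟩
  · rintro _ ⟨s, v, hv, rfl⟩
    exact ⟨(hv.isBlockMap s).mem_triplesE0, (hv.isBlockMap s).notMem_D5⟩
  · rintro B hB ⟨f, hf, hfB, hred⟩ hsub
    obtain ⟨d, Ψ, hΨ, hr⟩ := exists_isBlockMap_of_reduction hB hf hfB hred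
    obtain ⟨h1, h2, h3, hne⟩ := hΨ.mem_triplesE0
    exact hΨ.notMem_D5 (hsub ⟨hr h1, hr h2, hr h3, hne⟩)
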